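/- arXiv:2204.11472 — 2 statements merged into one kernel-verified Lean document; each statement's English description precedes it below -/
import Mathlib

section
/- (Existence of optimal densities, compact case.) Let m > 0 and k ≥ 1, and let D ⊂ ℝ^N be a fixed open bounded set. Then the problem sup{ μ_k(ρ) : ρ ∈ L¹(D,[0,1]), ∫_D ρ = m } admits a maximizer, provided the supremum is finite; indeed any weak-* limit of a maximizing sequence is a maximizer, since weak-* L^∞ convergence preserves the mass constraint on a bounded domain and eigenvalues are upper semicontinuous. -/
open MeasureTheory Set ENNReal Real

/-- The indicator of a set, as a linear map on real-valued functions. -/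
noncomputable def indicatorL {α : Type*} (s : Set α) : (α → ℝ) →ₗ[ℝ] (α → ℝ) where
  toFun f := s.indicator f
  map_add' f g := by ext x; by_cases h : x ∈ s <;> simp [Set.indicator_apply, h]
  map_smul' c f := by ext x; by_cases h : x ∈ s <;> simp [Set.indicator_apply, h]

/-- The `k`-th variational Neumann eigenvalue of a pair of densities `(ρ₁, ρ₂)` on `ℝ^N`:
the infimum, over subspaces of smooth compactly supported functions whose restriction to
`{ρ₂ > 0}` is `(k+1)`-dimensional, of the maximum of the Rayleigh quotient
`(∫ ρ₁ |∇u|²) / (∫ ρ₂ u²)` over nonzero elements. The value `⊤` corresponds to the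
convention `μ_k(0) = +∞` (empty admissible class). -/
noncomputable def mu2 (N k : ℕ) (ρ₁ ρ₂ : EuclideanSpace ℝ (Fin N) → ℝ) : ℝ≥0∞ :=
  ⨅ V : {V : Submodule ℝ (EuclideanSpace ℝ (Fin N) → ℝ) //
      (∀ u ∈ V, ContDiff ℝ (⊤ : ℕ∞) u ∧ HasCompactSupport u) ∧
      Module.finrank ℝ (V.map (indicatorL {x | 0 < ρ₂ x})) = k + 1},
    ⨆ u : {u : EuclideanSpace ℝ (Fin N) → ℝ //
      u ∈ V.1 ∧ indicatorL {x | 0 < ρ₂ x} u ≠ 0},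
    ENNReal.ofReal ((∫ x, ρ₁ x * ‖fderiv ℝ u.1 x‖ ^ 2) / (∫ x, ρ₂ x * (u.1 x) ^ 2))

/-- The `k`-th variational Neumann eigenvalue of a density `ρ` on `ℝ^N`. -/
noncomputable def mu (N k : ℕ) (ρ : EuclideanSpace ℝ (Fin N) → ℝ) : ℝ≥0∞ := mu2 N k ρ ρ

open Filter Topology

section Compactness

variable {α ι : Type*} [MeasurableSpace α] {μ : Measure α} [IsFiniteMeasure μ]

/-- Weak-* compactness of the densities with values in `[0, 1]` on a finite measure space, along an
ultrafilter and tested against square-integrable functions. -/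
theorem exists_tendsto_integral_mul_of_mem_Icc (F : Ultrafilter ι) {ρ : ι → α → ℝ}
    (hρ : ∀ i, Measurable (ρ i)) (hρ01 : ∀ i x, 0 ≤ ρ i x ∧ ρ i x ≤ 1) :
    ∃ f : α → ℝ, Measurable f ∧ (∀ x, 0 ≤ f x ∧ f x ≤ 1) ∧
      ∀ g : α → ℝ, MemLp g 2 μ →
        Tendsto (fun i => ∫ x, ρ i x * g x ∂μ) F (𝓝 (∫ x, f x * g x ∂μ)) := by
  have hmem (i : ι) : MemLp (ρ i) 2 μ :=
    MemLp.of_bound (hρ i).aestronglyMeasurable 1 (Eventually.of_forall fun x => by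
      rw [Real.norm_eq_abs, abs_le]; constructor <;> linarith [hρ01 i x])
  obtain ⟨r, hr⟩ : ∃ r : ℝ, ∀ i, ‖(hmem i).toLp‖ ≤ r := by
    have hone : MemLp (fun _ : α => (1 : ℝ)) 2 μ := memLp_const 1
    refine ⟨‖hone.toLp‖, fun i => Lp.norm_le_norm_of_ae_le ?_⟩
    filter_upwards [(hmem i).coeFn_toLp, hone.coeFn_toLp] with x hx hx'
    rw [hx, hx', norm_one, Real.norm_eq_abs, abs_of_nonneg (hρ01 i x).1]
    exact (hρ01 i x).2
  let φ : ι → WeakDual ℝ (Lp ℝ 2 μ) := fun i =>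
    StrongDual.toWeakDual (InnerProductSpace.toDual ℝ (Lp ℝ 2 μ) (hmem i).toLp)
  obtain ⟨ψ, -, hψ⟩ := (WeakDual.isCompact_closedBall (𝕜 := ℝ) (E := Lp ℝ 2 μ) 0 r
    ).ultrafilter_le_nhds (F.map φ) (by
      rw [Ultrafilter.coe_map, le_principal_iff, Filter.mem_map]
      refine Filter.univ_mem' fun i => ?_
      simp only [mem_preimage, mem_closedBall_zero_iff]
      change ‖InnerProductSpace.toDual ℝ (Lp ℝ 2 μ) (hmem i).toLp‖ ≤ r
      rw [LinearIsometryEquiv.norm_map]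
      exact hr i)
  let f₀ : Lp ℝ 2 μ := (InnerProductSpace.toDual ℝ (Lp ℝ 2 μ)).symm (WeakDual.toStrongDual ψ)
  have hlim (g : α → ℝ) (hg : MemLp g 2 μ) :
      Tendsto (fun i => ∫ x, ρ i x * g x ∂μ) F (𝓝 (∫ x, f₀ x * g x ∂μ)) := by
    have h := ((WeakDual.eval_continuous (hg.toLp)).tendsto ψ).comp (show Tendsto φ F (𝓝 ψ) from hψ)
    have h1 : ψ hg.toLp = ∫ x, f₀ x * g x ∂μ := by
      have : ψ hg.toLp = inner ℝ f₀ hg.toLp := by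
        rw [InnerProductSpace.toDual_symm_apply]; rfl
      rw [this, L2.inner_def]
      refine integral_congr_ae ?_
      filter_upwards [hg.coeFn_toLp] with x hx
      rw [hx]; simp [mul_comm]
    have h2 (i : ι) : φ i hg.toLp = ∫ x, ρ i x * g x ∂μ := by
      change inner ℝ (hmem i).toLp hg.toLp = _
      rw [L2.inner_def]
      refine integral_congr_ae ?_
      filter_upwards [hg.coeFn_toLp, (hmem i).coeFn_toLp] with x hx hx'
      rw [hx, hx']; simp [mul_comm]
    rw [← h1]
    exact h.congr h2
  have hf₀ : Integrable f₀ μ := (Lp.memLp f₀).integrable (by norm_num)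
  have hset (s : Set α) (hs : MeasurableSet s) :
      Tendsto (fun i => ∫ x in s, ρ i x ∂μ) F (𝓝 (∫ x in s, f₀ x ∂μ)) := by
    have h := hlim (s.indicator fun _ => 1) ((memLp_const 1).indicator hs)
    have key (u : α → ℝ) : ∫ x, u x * s.indicator (fun _ => 1) x ∂μ = ∫ x in s, u x ∂μ := by
      rw [← integral_indicator hs]
      congr 1; ext x
      by_cases hx : x ∈ s <;> simp [hx]
    simpa only [key] using h
  have hnonneg : 0 ≤ᵐ[μ] f₀ := ae_nonneg_of_forall_setIntegral_nonneg hf₀ fun s hs _ =>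
    ge_of_tendsto' (hset s hs) fun i => integral_nonneg fun x => (hρ01 i x).1
  have hle : f₀ ≤ᵐ[μ] fun _ => (1 : ℝ) :=
    ae_le_of_forall_setIntegral_le hf₀ (integrable_const 1) fun s hs _ =>
      le_of_tendsto' (hset s hs) fun i =>
        integral_mono ((hmem i).integrable (by norm_num)).integrableOn
          (integrable_const 1) fun x => (hρ01 i x).2
  have hmeas : Measurable f₀ := (Lp.stronglyMeasurable f₀).measurable
  refine ⟨fun x => max 0 (min (f₀ x) 1), by fun_prop, fun x => ⟨le_max_left _ _,
    max_le zero_le_one (min_le_right _ _)⟩, fun g hg => ?_⟩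
  have : ∫ x, max 0 (min (f₀ x) 1) * g x ∂μ = ∫ x, f₀ x * g x ∂μ := by
    refine integral_congr_ae ?_
    filter_upwards [hnonneg, hle] with x h0 h1
    rw [min_eq_left h1, max_eq_right (show (0 : ℝ) ≤ f₀ x from h0)]
  rw [this]
  exact hlim g hg

end Compactness

/-- A density can be modified on a null set so that its positivity set charges every neighbourhood
of each of its points. -/
theorem exists_indicator_ae_eq_forall_nhds_pos {X : Type*} [TopologicalSpace X]
    [HereditarilyLindelofSpace X] [MeasurableSpace X] [OpensMeasurableSpace X] {μ : Measure X}
    {ρ : X → ℝ} (hρ : Measurable ρ) (h0 : ∀ x, 0 ≤ ρ x) :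
    ∃ K : Set X, MeasurableSet K ∧ K.indicator ρ =ᵐ[μ] ρ ∧
      ∀ x, 0 < K.indicator ρ x → ∀ U ∈ 𝓝 x, 0 < μ (U ∩ {y | 0 < K.indicator ρ y}) := by
  have hP : MeasurableSet {x | 0 < ρ x} := measurableSet_lt measurable_const hρ
  set ν := μ.restrict {x | 0 < ρ x} with hν
  have hae : ν.support.indicator ρ =ᵐ[μ] ρ := by
    have h : ν ν.supportᶜ = 0 := Measure.measure_compl_support
    rw [hν, Measure.restrict_apply' hP, ← hν] at h
    refine measure_mono_null (fun x hx => ?_) h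
    by_cases hxs : x ∈ ν.support
    · simp [hxs] at hx
    · refine ⟨hxs, (h0 x).lt_of_ne fun h' => hx ?_⟩
      simp [hxs, ← h']
  refine ⟨ν.support, Measure.isClosed_support.measurableSet, hae, fun x hx U hU => ?_⟩
  have hxs : x ∈ ν.support := by
    by_contra h
    simp [h] at hx
  have h := (Measure.mem_support_iff_forall x).1 hxs U hU
  rw [hν, Measure.restrict_apply' hP] at h
  refine h.trans_eq (measure_congr ?_)
  filter_upwards [hae] with y hy
  change (y ∈ U ∧ 0 < ρ y) = (y ∈ U ∧ 0 < ν.support.indicator ρ y)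
  rw [hy]

/-- If the positivity set of `ρ` charges every neighbourhood of each of its points, a continuous
function of zero weighted `L²` norm vanishes at every point of that set. -/
theorem eq_zero_of_integral_mul_sq_eq_zero {X : Type*} [TopologicalSpace X] [MeasurableSpace X]
    {μ : Measure X} {ρ : X → ℝ} (h0 : ∀ x, 0 ≤ ρ x)
    (hpos : ∀ x, 0 < ρ x → ∀ U ∈ 𝓝 x, 0 < μ (U ∩ {y | 0 < ρ y})) {u : X → ℝ} (hu : Continuous u)
    (hint : Integrable (fun x => ρ x * u x ^ 2) μ) (h : ∫ x, ρ x * u x ^ 2 ∂μ = 0) {x : X}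
    (hx : 0 < ρ x) : u x = 0 := by
  by_contra hux
  have hae := (integral_eq_zero_iff_of_nonneg (fun y => mul_nonneg (h0 y) (sq_nonneg _)) hint).1 h
  refine (hpos x hx {y | u y ≠ 0} ((isOpen_ne_fun hu continuous_const).mem_nhds hux)).ne' ?_
  refine measure_mono_null (fun y hy => ?_) (ae_iff.1 hae)
  intro hy'
  exact (mul_pos hy.2 (sq_pos_of_ne_zero hy.1)).ne' hy'

/-- Positive definiteness of a quadratic form is an open condition on its coefficients. -/
theorem eventually_forall_sum_mul_pos {ι κ : Type*} [Fintype κ] {l : Filter ι}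
    {A : ι → κ → κ → ℝ} {B : κ → κ → ℝ} (hA : ∀ i j, Tendsto (fun n => A n i j) l (𝓝 (B i j)))
    (hB : ∀ c : κ → ℝ, c ≠ 0 → 0 < ∑ i, ∑ j, c i * c j * B i j) :
    ∀ᶠ n in l, ∀ c : κ → ℝ, c ≠ 0 → 0 < ∑ i, ∑ j, c i * c j * A n i j := by
  have hAB : Tendsto A l (𝓝 B) :=
    tendsto_pi_nhds.2 fun i => tendsto_pi_nhds.2 fun j => hA i j
  have hcont : Continuous fun p : (κ → κ → ℝ) × (κ → ℝ) =>
      ∑ i, ∑ j, p.2 i * p.2 j * p.1 i j := by fun_prop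
  have hev : ∀ᶠ M in 𝓝 B, ∀ c ∈ Metric.sphere (0 : κ → ℝ) 1,
      0 < ∑ i, ∑ j, c i * c j * M i j := by
    refine (isCompact_sphere _ _).eventually_forall_of_forall_eventually fun c hc => ?_
    exact hcont.continuousAt.eventually (lt_mem_nhds (hB c (ne_zero_of_mem_unit_sphere ⟨c, hc⟩)))
  filter_upwards [hAB.eventually hev] with n hn c hc
  have hc' : 0 < ‖c‖ := norm_pos_iff.2 hc
  have h := hn (‖c‖⁻¹ • c) (by simp [norm_smul, hc'.ne'])
  have heq : ∑ i, ∑ j, (‖c‖⁻¹ • c) i * (‖c‖⁻¹ • c) j * A n i j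
      = ‖c‖⁻¹ ^ 2 * ∑ i, ∑ j, c i * c j * A n i j := by
    simp only [Finset.mul_sum, Pi.smul_apply, smul_eq_mul]
    exact Finset.sum_congr rfl fun i _ => Finset.sum_congr rfl fun j _ => by ring
  rw [heq] at h
  exact pos_of_mul_pos_right h (by positivity)

theorem hasCompactSupport_inner {X H : Type*} [TopologicalSpace X]
    [NormedAddCommGroup H] [InnerProductSpace ℝ H]
    {f g : X → H} (hf : HasCompactSupport f) : HasCompactSupport fun x => inner ℝ (f x) (g x) :=
  hf.mono fun x hx hx' => hx (by simp [hx'])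

section Rayleigh

variable {X : Type*} [TopologicalSpace X] [MeasurableSpace X] [OpensMeasurableSpace X]
  {μ : Measure X} [IsFiniteMeasureOnCompacts μ]

theorem integrable_mul_of_hasCompactSupport {ρ g : X → ℝ} (hρ : Measurable ρ)
    (h01 : ∀ x, 0 ≤ ρ x ∧ ρ x ≤ 1) (hg : Continuous g) (hgs : HasCompactSupport g) :
    Integrable (fun x => ρ x * g x) μ :=
  (hg.integrable_of_hasCompactSupport hgs).bdd_mul (c := 1) hρ.aestronglyMeasurable
    (Eventually.of_forall fun x => by
      rw [Real.norm_eq_abs, abs_of_nonneg (h01 x).1]; exact (h01 x).2)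

theorem integral_mul_norm_sum_sq {κ H : Type*} [Fintype κ] [NormedAddCommGroup H]
    [InnerProductSpace ℝ H] {ρ : X → ℝ} (hρ : Measurable ρ) (h01 : ∀ x, 0 ≤ ρ x ∧ ρ x ≤ 1)
    {F : κ → X → H} (hF : ∀ i, Continuous (F i)) (hFs : ∀ i, HasCompactSupport (F i))
    (c : κ → ℝ) :
    ∫ x, ρ x * ‖∑ i, c i • F i x‖ ^ 2 ∂μ =
      ∑ i, ∑ j, c i * c j * ∫ x, ρ x * inner ℝ (F i x) (F j x) ∂μ := by
  have hint (i j : κ) : Integrable (fun x => c i * c j * (ρ x * inner ℝ (F i x) (F j x))) μ :=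
    (integrable_mul_of_hasCompactSupport hρ h01 ((hF i).inner (hF j))
      (hasCompactSupport_inner (hFs i))).const_mul _
  have heq (x : X) : ρ x * ‖∑ i, c i • F i x‖ ^ 2 =
      ∑ i, ∑ j, c i * c j * (ρ x * inner ℝ (F i x) (F j x)) := by
    rw [← real_inner_self_eq_norm_sq, sum_inner, Finset.mul_sum]
    refine Finset.sum_congr rfl fun i _ => ?_
    rw [inner_sum, Finset.mul_sum]
    refine Finset.sum_congr rfl fun j _ => ?_
    rw [real_inner_smul_left, real_inner_smul_right]
    ring
  simp_rw [heq]
  rw [integral_finsetSum _ fun i _ => integrable_finsetSum _ fun j _ => hint i j]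
  refine Finset.sum_congr rfl fun i _ => ?_
  rw [integral_finsetSum _ fun j _ => hint i j]
  exact Finset.sum_congr rfl fun j _ => integral_const_mul _ _

end Rayleigh

theorem indicatorL_eq_zero_iff {α : Type*} {s : Set α} {f : α → ℝ} :
    indicatorL s f = 0 ↔ ∀ x ∈ s, f x = 0 := by
  refine Set.indicator_eq_zero'.trans ⟨fun h x hx => by_contra fun h' => Set.disjoint_left.1 h h' hx,
    fun h => Set.disjoint_left.2 fun x hx hx' => hx (h x hx')⟩

/-- Upper semicontinuity of `mu` under convergence of the densities against continuous compactly
supported functions, at a density whose positivity set charges every neighbourhood of each of its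
points. -/
theorem eventually_mu_le_of_tendsto {ι : Type*} {l : Filter ι} {N k : ℕ}
    {ρ : ι → EuclideanSpace ℝ (Fin N) → ℝ} {σ : EuclideanSpace ℝ (Fin N) → ℝ}
    (hρ : ∀ i, Measurable (ρ i)) (hρ01 : ∀ i x, 0 ≤ ρ i x ∧ ρ i x ≤ 1)
    (hσ : Measurable σ) (hσ01 : ∀ x, 0 ≤ σ x ∧ σ x ≤ 1)
    (hpos : ∀ x, 0 < σ x → ∀ U ∈ 𝓝 x, 0 < volume (U ∩ {y | 0 < σ y}))
    (hlim : ∀ g : EuclideanSpace ℝ (Fin N) → ℝ, Continuous g → HasCompactSupport g →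
      Tendsto (fun i => ∫ x, ρ i x * g x) l (𝓝 (∫ x, σ x * g x)))
    {b : ℝ≥0∞} (hb : mu N k σ < b) : ∀ᶠ i in l, mu N k (ρ i) ≤ b := by
  rcases eq_or_ne b ⊤ with rfl | hbtop
  · exact Eventually.of_forall fun _ => le_top
  obtain ⟨⟨V, hV, hrank⟩, hVb⟩ := iInf_lt_iff.1 hb
  have : Module.Finite ℝ (V.map (indicatorL {x | 0 < σ x})) :=
    Module.finite_of_finrank_pos (by omega)
  let basis := Module.finBasisOfFinrankEq ℝ _ hrank
  choose e heV hei using fun i => Submodule.mem_map.1 (basis i).2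
  have hli : LinearIndependent ℝ fun i => indicatorL {x | 0 < σ x} (e i) := by
    have := basis.linearIndependent.map' (Submodule.subtype _) (Submodule.ker_subtype _)
    rwa [show ⇑(Submodule.subtype _) ∘ ⇑basis = fun i => indicatorL {x | 0 < σ x} (e i) from
      funext fun i => (hei i).symm] at this
  have hcont (i) : Continuous (e i) := (hV _ (heV i)).1.continuous
  have hsupp (i) : HasCompactSupport (e i) := (hV _ (heV i)).2
  let G : Fin (k + 1) → EuclideanSpace ℝ (Fin N) → EuclideanSpace ℝ (Fin N) := fun i x =>
    (InnerProductSpace.toDual ℝ _).symm (fderiv ℝ (e i) x)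
  have hGcont (i) : Continuous (G i) :=
    (LinearIsometryEquiv.continuous _).comp ((hV _ (heV i)).1.continuous_fderiv (by simp))
  have hGsupp (i) : HasCompactSupport (G i) :=
    ((hsupp i).fderiv ℝ).mono fun x hx hx' => hx (by simp [G, hx'])
  let u : (Fin (k + 1) → ℝ) → EuclideanSpace ℝ (Fin N) → ℝ := fun c => ∑ i, c i • e i
  have huV (c) : u c ∈ V := V.sum_mem fun i _ => V.smul_mem _ (heV i)
  have hind (s : Set (EuclideanSpace ℝ (Fin N))) (c) :
      indicatorL s (u c) = ∑ i, c i • indicatorL s (e i) := by simp [u, map_sum]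
  have hden (τ : EuclideanSpace ℝ (Fin N) → ℝ) (hτ : Measurable τ)
      (h01 : ∀ x, 0 ≤ τ x ∧ τ x ≤ 1) (c) : ∫ x, τ x * u c x ^ 2 =
        ∑ i, ∑ j, c i * c j * ∫ x, τ x * inner ℝ (e i x) (e j x) := by
    rw [← integral_mul_norm_sum_sq hτ h01 hcont hsupp]
    simp [u]
  have hnum (τ : EuclideanSpace ℝ (Fin N) → ℝ) (hτ : Measurable τ)
      (h01 : ∀ x, 0 ≤ τ x ∧ τ x ≤ 1) (c) : ∫ x, τ x * ‖fderiv ℝ (u c) x‖ ^ 2 =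
        ∑ i, ∑ j, c i * c j * ∫ x, τ x * inner ℝ (G i x) (G j x) := by
    rw [← integral_mul_norm_sum_sq hτ h01 hGcont hGsupp]
    congr 1; ext x
    have hd (i) : DifferentiableAt ℝ (e i) x :=
      ((hV _ (heV i)).1.differentiable (by simp)).differentiableAt
    have : ∑ i, c i • G i x = (InnerProductSpace.toDual ℝ _).symm (fderiv ℝ (u c) x) := by
      rw [fderiv_sum fun i _ => (hd i).const_smul (c i), map_sum]
      refine Finset.sum_congr rfl fun i _ => ?_
      rw [fderiv_const_smul (hd i)]
      simp [G]
    rw [this, LinearIsometryEquiv.norm_map]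
  have hne (c) (hc : c ≠ 0) : indicatorL {x | 0 < σ x} (u c) ≠ 0 := fun h => by
    rw [hind] at h
    exact hc (funext (Fintype.linearIndependent_iff.1 hli c h))
  have hσden (c) (hc : c ≠ 0) : 0 < ∫ x, σ x * u c x ^ 2 := by
    refine (integral_nonneg fun x => mul_nonneg (hσ01 x).1 (sq_nonneg _)).lt_of_ne' fun h => ?_
    have huc := (hV _ (huV c)).1.continuous
    refine hne c hc (indicatorL_eq_zero_iff.2 fun x hx => eq_zero_of_integral_mul_sq_eq_zero
      (fun x => (hσ01 x).1) hpos huc ?_ h hx)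
    refine integrable_mul_of_hasCompactSupport hσ hσ01 (huc.pow 2) ?_
    exact (hV _ (huV c)).2.mono fun x hx hx' => hx (by simp [hx'])
  have hσnum (c) (hc : c ≠ 0) :
      ∫ x, σ x * ‖fderiv ℝ (u c) x‖ ^ 2 < b.toReal * ∫ x, σ x * u c x ^ 2 := by
    have h := (le_iSup (fun u : {u : EuclideanSpace ℝ (Fin N) → ℝ //
      u ∈ V ∧ indicatorL {x | 0 < σ x} u ≠ 0} => ENNReal.ofReal
        ((∫ x, σ x * ‖fderiv ℝ u.1 x‖ ^ 2) / (∫ x, σ x * (u.1 x) ^ 2)))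
          ⟨u c, huV c, hne c hc⟩).trans_lt hVb
    rw [ENNReal.ofReal_lt_iff_lt_toReal ?_ hbtop, div_lt_iff₀ (hσden c hc)] at h
    · exact h
    · exact div_nonneg (integral_nonneg fun x => mul_nonneg (hσ01 x).1 (sq_nonneg _))
        (hσden c hc).le
  have hlimD (i j) := hlim _ ((hcont i).inner (𝕜 := ℝ) (hcont j))
    (hasCompactSupport_inner (g := e j) (hsupp i))
  have hlimG (i j) := hlim _ ((hGcont i).inner (𝕜 := ℝ) (hGcont j))
    (hasCompactSupport_inner (g := G j) (hGsupp i))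
  have hcomb (τ : EuclideanSpace ℝ (Fin N) → ℝ) (hτ : Measurable τ)
      (h01 : ∀ x, 0 ≤ τ x ∧ τ x ≤ 1) (c) :
      ∑ i, ∑ j, c i * c j * (b.toReal * (∫ x, τ x * inner ℝ (e i x) (e j x)) -
        ∫ x, τ x * inner ℝ (G i x) (G j x)) =
      b.toReal * (∫ x, τ x * u c x ^ 2) - ∫ x, τ x * ‖fderiv ℝ (u c) x‖ ^ 2 := by
    rw [hden τ hτ h01, hnum τ hτ h01, Finset.mul_sum, ← Finset.sum_sub_distrib]
    refine Finset.sum_congr rfl fun i _ => ?_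
    rw [Finset.mul_sum, ← Finset.sum_sub_distrib]
    exact Finset.sum_congr rfl fun j _ => by ring
  have hevD := eventually_forall_sum_mul_pos hlimD fun c hc => by
    rw [← hden σ hσ hσ01]; exact hσden c hc
  have hevQ := eventually_forall_sum_mul_pos
    (fun i j => ((hlimD i j).const_mul b.toReal).sub (hlimG i j)) fun c hc => by
      rw [hcomb σ hσ hσ01]; exact sub_pos.2 (hσnum c hc)
  filter_upwards [hevD, hevQ] with n hD hQ
  simp only [hcomb _ (hρ n) (hρ01 n)] at hQ
  simp only [← hden _ (hρ n) (hρ01 n)] at hD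
  have hlin : LinearIndependent ℝ fun i => indicatorL {x | 0 < ρ n x} (e i) := by
    refine Fintype.linearIndependent_iff.2 fun c hc i => ?_
    by_contra hci
    have hc0 : c ≠ 0 := fun h => hci (by simp [h])
    rw [← hind, indicatorL_eq_zero_iff] at hc
    refine (hD c hc0).ne' (integral_eq_zero_of_ae (Eventually.of_forall fun x => ?_))
    rcases (hρ01 n x).1.eq_or_lt with hx | hx
    · simp [← hx]
    · simp [hc x hx]
  have hspan : ∀ w ∈ Submodule.span ℝ (range e), ∃ c, u c = w := fun w hw =>
    (Submodule.mem_span_range_iff_exists_fun ℝ).1 hw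
  have hVspan : ∀ w ∈ Submodule.span ℝ (range e), ContDiff ℝ (⊤ : ℕ∞) w ∧ HasCompactSupport w :=
    fun w hw => by
      obtain ⟨c, rfl⟩ := hspan w hw
      exact hV _ (huV c)
  have hVrank : Module.finrank ℝ ((Submodule.span ℝ (range e)).map
      (indicatorL {x | 0 < ρ n x})) = k + 1 := by
    rw [Submodule.map_span, ← range_comp]
    exact (finrank_span_eq_card hlin).trans (Fintype.card_fin _)
  refine (iInf_le _ ⟨Submodule.span ℝ (range e), hVspan, hVrank⟩).trans (iSup_le ?_)
  rintro ⟨w, hw, hne⟩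
  obtain ⟨c, rfl⟩ := hspan w hw
  have hc0 : c ≠ 0 := by
    rintro rfl
    exact hne (by rw [hind]; simp)
  refine ENNReal.ofReal_le_of_le_toReal ?_
  rw [div_le_iff₀ (hD c hc0)]
  exact (sub_pos.1 (hQ c hc0)).le

/-- Existence of optimal densities, compact case: on a bounded open set `D ⊂ ℝ^N`,
the problem `sup{μ_k(ρ) : ρ : D → [0,1], ∫ρ = m}` admits a maximizer, provided the
class is nonempty and the supremum is finite. -/
theorem stmt_12 (N : ℕ) (hN : 1 ≤ N) (D : Set (EuclideanSpace ℝ (Fin N)))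
    (hD : IsOpen D) (hDb : Bornology.IsBounded D) (m : ℝ) (hm : 0 < m)
    (k : ℕ) (hk : 1 ≤ k) (C : Set (EuclideanSpace ℝ (Fin N) → ℝ))
    (hC : C = {ρ | Measurable ρ ∧ (∀ x, 0 ≤ ρ x ∧ ρ x ≤ 1) ∧
      (∀ x ∉ D, ρ x = 0) ∧ (∫ x, ρ x) = m})
    (hne : C.Nonempty) (hfin : (⨆ ρ ∈ C, mu N k ρ) ≠ ⊤) :
    ∃ ρ ∈ C, ∀ σ ∈ C, mu N k σ ≤ mu N k ρ := by
  subst hC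
  set C : Set (EuclideanSpace ℝ (Fin N) → ℝ) := {ρ | Measurable ρ ∧
    (∀ x, 0 ≤ ρ x ∧ ρ x ≤ 1) ∧ (∀ x ∉ D, ρ x = 0) ∧ (∫ x, ρ x) = m}
  obtain ⟨s, -, hs, hsC⟩ := exists_seq_tendsto_sSup (hne.image (mu N k)) (OrderTop.bddAbove _)
  choose ρ hρC hρs using hsC
  have : IsFiniteMeasure (volume.restrict D) :=
    isFiniteMeasure_restrict.2 hDb.measure_lt_top.ne
  obtain ⟨f, hf, hf01, hlim⟩ := exists_tendsto_integral_mul_of_mem_Icc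
    (μ := volume.restrict D) (Ultrafilter.of atTop) (fun n => (hρC n).1) fun n => (hρC n).2.1
  obtain ⟨K, hK, hae, hpos⟩ := exists_indicator_ae_eq_forall_nhds_pos (μ := volume)
    (hf.indicator hD.measurableSet) (indicator_nonneg fun x _ => (hf01 x).1)
  set σ := K.indicator (D.indicator f)
  have hσ : Measurable σ := (hf.indicator hD.measurableSet).indicator hK
  have hσ01 (x) : 0 ≤ σ x ∧ σ x ≤ 1 := by
    by_cases hxK : x ∈ K <;> by_cases hxD : x ∈ D <;> simp [σ, hxK, hxD, hf01]
  have hσD : ∀ x ∉ D, σ x = 0 := fun x hx => by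
    by_cases hxK : x ∈ K <;> simp [σ, hxK, hx]
  have hrestr (τ : EuclideanSpace ℝ (Fin N) → ℝ) (hτ : ∀ x ∉ D, τ x = 0)
      (g : EuclideanSpace ℝ (Fin N) → ℝ) : ∫ x in D, τ x * g x = ∫ x, τ x * g x :=
    setIntegral_eq_integral_of_forall_compl_eq_zero fun x hx => by simp [hτ x hx]
  have hfσ (g : EuclideanSpace ℝ (Fin N) → ℝ) : ∫ x in D, f x * g x = ∫ x, σ x * g x := by
    rw [← hrestr σ hσD]
    refine integral_congr_ae ?_
    filter_upwards [ae_restrict_of_ae hae, ae_restrict_mem hD.measurableSet] with x hx hxD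
    rw [hx, indicator_of_mem hxD]
  have hlim' (g : EuclideanSpace ℝ (Fin N) → ℝ) (hg : MemLp g 2 (volume.restrict D)) :
      Tendsto (fun n => ∫ x, ρ n x * g x) (Ultrafilter.of atTop : Ultrafilter ℕ)
        (𝓝 (∫ x, σ x * g x)) := by
    rw [← hfσ]
    exact (hlim g hg).congr fun n => hrestr _ (hρC n).2.2.1 g
  have hmass : ∫ x, σ x = m := by
    have h := hlim' (fun _ => 1) (memLp_const 1)
    simp only [mul_one, (hρC _).2.2.2] at h
    exact tendsto_nhds_unique h tendsto_const_nhds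
  refine ⟨σ, ⟨hσ, hσ01, hσD, hmass⟩, fun τ hτ => ?_⟩
  by_contra! hlt
  have hlt' : mu N k σ < sSup (mu N k '' C) := hlt.trans_le (le_sSup (mem_image_of_mem _ hτ))
  obtain ⟨b, hb, hb'⟩ := exists_between hlt'
  have hle := eventually_mu_le_of_tendsto (fun n => (hρC n).1) (fun n => (hρC n).2.1) hσ hσ01 hpos
    (fun g hg hgs => hlim' g ((hg.memLp_of_hasCompactSupport hgs).restrict D)) hb
  have hgt : ∀ᶠ n in (Ultrafilter.of atTop : Ultrafilter ℕ), b < s n :=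
    (hs.mono_left (Ultrafilter.of_le atTop)).eventually (lt_mem_nhds hb')
  obtain ⟨n, hn, hn'⟩ := (hle.and hgt).exists
  exact hn'.not_ge (hρs n ▸ hn)
end

section
/- Let (ρ_n) ⊂ L¹(ℝ^N, [0,1]) with ∫ρ_n = m be a maximizing sequence for μ_k over the mass-constrained class, with sup_n μ_k(ρ_n) converging to a positive limit. Then vanishing cannot occur: it is false that for every R > 0, sup_{y ∈ ℝ^N} ∫_{B(y,R)} ρ_n dx → 0 as n → ∞. -/
open MeasureTheory Set ENNReal Real

theorem hasCompactSupport_finset_sum {X ι : Type*} [TopologicalSpace X] {f : ι → X → ℝ}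
    {s : Finset ι} (h : ∀ i, HasCompactSupport (f i)) :
    HasCompactSupport fun x => ∑ i ∈ s, f i x := by
  classical
  induction s using Finset.induction_on with
  | empty => exact HasCompactSupport.zero
  | insert i s hi ih => simp only [Finset.sum_insert hi]; exact (h i).add ih

theorem integrable_mul_sq {N : ℕ} {ρ u : EuclideanSpace ℝ (Fin N) → ℝ} (hint : Integrable ρ)
    (hu : Continuous u) (hc : HasCompactSupport u) : Integrable (fun x => ρ x * u x ^ 2) := by
  obtain ⟨C, hC⟩ := hc.exists_bound_of_continuous hu
  refine hint.mul_bdd (c := C ^ 2) (hu.pow 2).aestronglyMeasurable (.of_forall fun x => ?_)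
  rw [norm_pow]
  exact pow_le_pow_left₀ (norm_nonneg _) (hC x) 2

/-- Test functions with disjoint supports bound the variational eigenvalue from above. -/
theorem mu_le_of_disjoint {N k : ℕ} {ρ : EuclideanSpace ℝ (Fin N) → ℝ} (h0 : ∀ x, 0 ≤ ρ x)
    (hint : Integrable ρ) {u : Fin (k + 1) → EuclideanSpace ℝ (Fin N) → ℝ}
    (hu : ∀ j, ContDiff ℝ (⊤ : ℕ∞) (u j)) (hc : ∀ j, HasCompactSupport (u j))
    (hdisj : ∀ i j, i ≠ j → ∀ x, u i x * u j x = 0) {B a : ℝ} (ha : 0 < a)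
    (hB : ∀ j x, ‖fderiv ℝ (u j) x‖ ≤ B) (hmass : ∀ j, a ≤ ∫ x, ρ x * u j x ^ 2) :
    mu N k ρ ≤ ENNReal.ofReal ((k + 1) * B ^ 2 * (∫ x, ρ x) / a) := by
  have hpt : ∀ j, ∃ x, 0 < ρ x ∧ u j x ≠ 0 := by
    intro j
    by_contra! h
    have : ∫ x, ρ x * u j x ^ 2 = 0 := by
      refine integral_eq_zero_of_ae (.of_forall fun x => ?_)
      rcases (h0 x).eq_or_lt with hx | hx
      · simp [← hx]
      · simp [h x hx]
    linarith [hmass j]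
  choose p hp hup using hpt
  have hup' : ∀ i j, i ≠ j → u i (p j) = 0 := fun i j hij =>
    (mul_eq_zero.1 (hdisj i j hij (p j))).resolve_right (hup j)
  have hli : LinearIndependent ℝ (fun j => indicatorL {x | 0 < ρ x} (u j)) := by
    rw [Fintype.linearIndependent_iff]
    intro g hg j
    have h1 := congrFun hg (p j)
    simp only [Finset.sum_apply, Pi.smul_apply, Pi.zero_apply, smul_eq_mul] at h1
    rw [Finset.sum_eq_single j] at h1
    · simpa [indicatorL, hp j, hup j] using h1
    · intro i _ hij
      simp [indicatorL, hup' i j hij]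
    · simp
  have hspan : ∀ v ∈ Submodule.span ℝ (range u), ∃ c : Fin (k + 1) → ℝ,
      v = fun x => ∑ j, c j * u j x := by
    intro v hv
    obtain ⟨c, rfl⟩ := (Submodule.mem_span_range_iff_exists_fun ℝ).1 hv
    exact ⟨c, by ext x; simp⟩
  have hsmooth : ∀ v ∈ Submodule.span ℝ (range u),
      ContDiff ℝ (⊤ : ℕ∞) v ∧ HasCompactSupport v := by
    intro v hv
    induction hv using Submodule.span_induction with
    | mem v hv => obtain ⟨j, rfl⟩ := hv; exact ⟨hu j, hc j⟩
    | zero => exact ⟨contDiff_const, HasCompactSupport.zero⟩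
    | add v w _ _ hv hw => exact ⟨hv.1.add hw.1, hv.2.add hw.2⟩
    | smul c v _ hv => exact ⟨hv.1.const_smul c, hv.2.smul_left (f := fun _ => c)⟩
  have hdim : Module.finrank ℝ
      ((Submodule.span ℝ (range u)).map (indicatorL {x | 0 < ρ x})) = k + 1 := by
    rw [Submodule.map_span, ← range_comp]
    exact (finrank_span_eq_card hli).trans (Fintype.card_fin _)
  refine iInf_le_of_le ⟨Submodule.span ℝ (range u), hsmooth, hdim⟩ (iSup_le ?_)
  rintro ⟨v, hv, -⟩
  apply ENNReal.ofReal_le_ofReal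
  obtain ⟨c, rfl⟩ := hspan v hv
  have hm0 : 0 ≤ ∫ x, ρ x := integral_nonneg h0
  have hint2 : ∀ j, Integrable (fun x => ρ x * u j x ^ 2) := fun j =>
    integrable_mul_sq hint (hu j).continuous (hc j)
  have hden : a * ∑ j, c j ^ 2 ≤ ∫ x, ρ x * (∑ j, c j * u j x) ^ 2 := by
    have hsq : ∀ x, ρ x * (∑ j, c j * u j x) ^ 2 = ∑ j, c j ^ 2 * (ρ x * u j x ^ 2) := by
      intro x
      rw [sq, Finset.sum_mul_sum, Finset.mul_sum]
      refine Finset.sum_congr rfl fun i _ => ?_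
      rw [Finset.sum_eq_single i]
      · ring
      · intro j _ hji
        linear_combination c i * c j * hdisj i j hji.symm x
      · simp
    simp_rw [hsq]
    rw [integral_finsetSum _ fun j _ => (hint2 j).const_mul _, Finset.mul_sum]
    refine Finset.sum_le_sum fun j _ => ?_
    rw [integral_const_mul, mul_comm]
    exact mul_le_mul_of_nonneg_left (hmass j) (sq_nonneg _)
  have hgrad : ∀ x, ‖fderiv ℝ (fun x => ∑ j, c j * u j x) x‖ ^ 2
      ≤ (k + 1) * B ^ 2 * ∑ j, c j ^ 2 := by
    intro x
    have hd : fderiv ℝ (fun x => ∑ j, c j * u j x) x = ∑ j, c j • fderiv ℝ (u j) x := by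
      refine HasFDerivAt.fderiv (HasFDerivAt.fun_sum fun j _ => ?_)
      exact (((hu j).differentiable (by simp)) x).hasFDerivAt.const_mul (c j)
    have h1 : ‖fderiv ℝ (fun x => ∑ j, c j * u j x) x‖ ≤ ∑ j, |c j| * B := by
      rw [hd]
      refine norm_sum_le_of_le _ fun j _ => ?_
      rw [norm_smul, Real.norm_eq_abs]
      exact mul_le_mul_of_nonneg_left (hB j x) (abs_nonneg _)
    calc _ ≤ (∑ j, |c j| * B) ^ 2 := pow_le_pow_left₀ (norm_nonneg _) h1 2
      _ ≤ _ := by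
        refine (sq_sum_le_card_mul_sum_sq (s := Finset.univ)).trans (le_of_eq ?_)
        simp only [mul_pow, sq_abs, ← Finset.sum_mul, Finset.card_univ, Fintype.card_fin]
        push_cast
        ring
  have hnum : ∫ x, ρ x * ‖fderiv ℝ (fun x => ∑ j, c j * u j x) x‖ ^ 2
      ≤ (∫ x, ρ x) * ((k + 1) * B ^ 2 * ∑ j, c j ^ 2) := by
    rw [← integral_mul_const]
    refine integral_mono_of_nonneg (.of_forall fun x => mul_nonneg (h0 x) (sq_nonneg _))
      (hint.mul_const _) (.of_forall fun x => mul_le_mul_of_nonneg_left (hgrad x) (h0 x))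
  have hsum : 0 ≤ ∑ j, c j ^ 2 := Finset.sum_nonneg fun j _ => sq_nonneg _
  refine div_le_of_le_mul₀ ((mul_nonneg ha.le hsum).trans hden) (by positivity) (hnum.trans ?_)
  refine le_trans (le_of_eq ?_) (mul_le_mul_of_nonneg_left hden (by positivity))
  field_simp

/-- Greedy choice: small weights of large total can be grouped into `K` disjoint heavy sets. -/
theorem exists_disjoint_heavy_subsets {ι : Type*} [DecidableEq ι] {w : ι → ℝ} {δ a : ℝ}
    (hw : ∀ i, w i ≤ δ) (ha : 0 < a) (K : ℕ) (S : Finset ι)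
    (hS : K * (a + δ) ≤ ∑ i ∈ S, w i) (hδ : 0 ≤ δ) :
    ∃ G : Fin K → Finset ι, (∀ j, G j ⊆ S) ∧ (∀ i j, i ≠ j → Disjoint (G i) (G j)) ∧
      ∀ j, a ≤ ∑ i ∈ G j, w i := by
  have hone : ∀ S : Finset ι, a ≤ ∑ i ∈ S, w i →
      ∃ T ⊆ S, a ≤ ∑ i ∈ T, w i ∧ ∑ i ∈ T, w i ≤ a + δ := by
    intro S
    induction S using Finset.induction_on with
    | empty => intro h; simp at h; linarith
    | insert i S hi ih =>
      intro h
      by_cases hle : a ≤ ∑ i ∈ S, w i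
      · obtain ⟨T, hT, h'⟩ := ih hle
        exact ⟨T, hT.trans (Finset.subset_insert _ _), h'⟩
      · refine ⟨_, subset_rfl, h, ?_⟩
        rw [Finset.sum_insert hi]
        linarith [hw i]
  induction K generalizing S with
  | zero => exact ⟨fun _ => ∅, fun j => j.elim0, fun j => j.elim0, fun j => j.elim0⟩
  | succ K ih =>
    push_cast at hS
    have hK : 0 ≤ (K : ℝ) * (a + δ) := by positivity
    obtain ⟨T, hTS, hT1, hT2⟩ := hone S (by linarith)
    have hsd := Finset.sum_sdiff (f := w) hTS
    obtain ⟨G, hG, hGd, hGa⟩ := ih (S \ T) (by linarith)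
    have hGT : ∀ j, Disjoint T (G j) := fun j =>
      Finset.disjoint_sdiff.mono_right (hG j)
    refine ⟨Fin.cons T G, Fin.cases hTS fun j => (hG j).trans Finset.sdiff_subset, ?_,
      Fin.cases hT1 hGa⟩
    refine Fin.cases (Fin.cases (fun h => (h rfl).elim) fun j _ => hGT j)
      fun i => Fin.cases (fun _ => (hGT i).symm) fun j hij => hGd i j fun h => hij (by rw [h])

/-- The lattice vector of `ℝ^N` with integer coordinates `z`. -/
noncomputable def latticeVec {N : ℕ} (z : Fin N → ℤ) : EuclideanSpace ℝ (Fin N) :=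
  WithLp.toLp 2 fun i => (z i : ℝ)

/-- The index of the cell of the grid of mesh `R` that contains `x`. -/
noncomputable def cellIndex {N : ℕ} (R : ℝ) (x : EuclideanSpace ℝ (Fin N)) : Fin N → ℤ :=
  fun i => ⌊R⁻¹ * x i⌋

theorem measurable_cellIndex {N : ℕ} (R : ℝ) :
    Measurable (cellIndex R : EuclideanSpace ℝ (Fin N) → Fin N → ℤ) := by
  refine measurable_pi_lambda _ fun i => Int.measurable_floor.comp ?_
  fun_prop

theorem norm_sub_latticeVec_lt {N : ℕ} (R : ℝ) (x : EuclideanSpace ℝ (Fin N)) :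
    ‖R⁻¹ • x - latticeVec (cellIndex R x)‖ < N + 1 := by
  rw [EuclideanSpace.norm_eq]
  have h : ∑ i, ‖(R⁻¹ • x - latticeVec (cellIndex R x)) i‖ ^ 2 ≤ N := by
    refine (Finset.sum_le_card_nsmul _ _ 1 fun i _ => ?_).trans (by simp)
    have h1 := Int.floor_le (R⁻¹ * x i)
    have h2 := Int.lt_floor_add_one (R⁻¹ * x i)
    simp only [latticeVec, cellIndex, PiLp.sub_apply, PiLp.smul_apply, smul_eq_mul]
    rw [Real.norm_eq_abs, sq_abs]
    nlinarith
  rw [Real.sqrt_lt' (by positivity)]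
  nlinarith [(Nat.cast_nonneg N : (0 : ℝ) ≤ N)]

theorem cell_subset_ball {N : ℕ} {R : ℝ} (hR : 0 < R) (z : Fin N → ℤ) :
    cellIndex R ⁻¹' {z} ⊆ Metric.ball (R • latticeVec z) (R * (N + 1)) := by
  rintro x rfl
  rw [mem_ball_iff_norm]
  have : x - R • latticeVec (cellIndex R x) = R • (R⁻¹ • x - latticeVec (cellIndex R x)) := by
    rw [smul_sub, smul_inv_smul₀ hR.ne']
  rw [this, norm_smul, Real.norm_of_nonneg hR.le]
  exact mul_lt_mul_of_pos_left (norm_sub_latticeVec_lt R x) hR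

/-- The smooth bump used on each cell, in rescaled coordinates. -/
noncomputable def cellBump (N : ℕ) : ContDiffBump (0 : EuclideanSpace ℝ (Fin N)) where
  rIn := N + 1
  rOut := 2 * (N + 1)
  rIn_pos := by positivity
  rIn_lt_rOut := by linarith [(Nat.cast_nonneg N : (0 : ℝ) ≤ N)]

/-- The translated and rescaled bump associated with the cell of index `z`. -/
noncomputable def gridBump {N : ℕ} (R : ℝ) (z : Fin N → ℤ) (x : EuclideanSpace ℝ (Fin N)) : ℝ :=
  cellBump N (R⁻¹ • x - latticeVec z)

theorem contDiff_gridBump {N : ℕ} (R : ℝ) (z : Fin N → ℤ) :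
    ContDiff ℝ (⊤ : ℕ∞) (gridBump R z) :=
  (cellBump N).contDiff.comp ((contDiff_id.const_smul R⁻¹).sub contDiff_const)

theorem gridBump_eq_zero {N : ℕ} {R : ℝ} {z : Fin N → ℤ} {x : EuclideanSpace ℝ (Fin N)}
    (h : 2 * (N + 1) ≤ ‖R⁻¹ • x - latticeVec z‖) : gridBump R z x = 0 :=
  (cellBump N).zero_of_le_dist (by simpa [cellBump] using h)

theorem gridBump_cellIndex {N : ℕ} (R : ℝ) (x : EuclideanSpace ℝ (Fin N)) :
    gridBump R (cellIndex R x) x = 1 :=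
  (cellBump N).one_of_mem_closedBall
    (by simpa [cellBump] using (norm_sub_latticeVec_lt R x).le)

theorem hasCompactSupport_gridBump {N : ℕ} {R : ℝ} (hR : 0 < R) (z : Fin N → ℤ) :
    HasCompactSupport (gridBump R z) := by
  refine HasCompactSupport.intro
    (isCompact_closedBall (R • latticeVec z) (R * (2 * (N + 1)))) fun x hx => ?_
  refine gridBump_eq_zero ?_
  rw [Metric.mem_closedBall, dist_eq_norm, not_le] at hx
  have : x - R • latticeVec z = R • (R⁻¹ • x - latticeVec z) := by
    rw [smul_sub, smul_inv_smul₀ hR.ne']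
  rw [this, norm_smul, Real.norm_of_nonneg hR.le] at hx
  exact (lt_of_mul_lt_mul_left hx hR.le).le

theorem fderiv_gridBump {N : ℕ} (R : ℝ) (z : Fin N → ℤ) (x : EuclideanSpace ℝ (Fin N)) :
    fderiv ℝ (gridBump R z) x = R⁻¹ • fderiv ℝ (cellBump N) (R⁻¹ • x - latticeVec z) := by
  have h1 : HasFDerivAt (fun x : EuclideanSpace ℝ (Fin N) => R⁻¹ • x - latticeVec z)
      (R⁻¹ • ContinuousLinearMap.id ℝ (EuclideanSpace ℝ (Fin N))) x :=
    ((hasFDerivAt_id x).const_smul R⁻¹).sub_const _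
  have h2 : HasFDerivAt (cellBump N) (fderiv ℝ (cellBump N) (R⁻¹ • x - latticeVec z))
      (R⁻¹ • x - latticeVec z) :=
    (((cellBump N).contDiff (n := 1)).differentiable (by simp) _).hasFDerivAt
  rw [show gridBump R z = cellBump N ∘ fun x => R⁻¹ • x - latticeVec z from rfl,
    (h2.comp x h1).fderiv]
  ext v
  simp

theorem fderiv_gridBump_eq_zero {N : ℕ} {R : ℝ} {z : Fin N → ℤ} {x : EuclideanSpace ℝ (Fin N)}
    (h : 2 * (N + 1) < ‖R⁻¹ • x - latticeVec z‖) : fderiv ℝ (gridBump R z) x = 0 := by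
  rw [fderiv_gridBump]
  have : fderiv ℝ (cellBump N) (R⁻¹ • x - latticeVec z) = 0 := by
    refine fderiv_of_notMem_tsupport (𝕜 := ℝ) ?_
    rw [(cellBump N).tsupport_eq]
    simpa [cellBump] using h
  rw [this, smul_zero]

/-- The colour of a cell. -/
def colour {N : ℕ} (z : Fin N → ℤ) : Fin N → ZMod (4 * (N + 1) + 1) := fun i => (z i : ZMod _)

/-- Cells of the same colour have bumps with disjoint closed supports. -/
theorem eq_of_colour_eq {N : ℕ} {R : ℝ} {z z' : Fin N → ℤ} {x : EuclideanSpace ℝ (Fin N)}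
    (hcol : colour z = colour z') (hz : ‖R⁻¹ • x - latticeVec z‖ ≤ 2 * (N + 1))
    (hz' : ‖R⁻¹ • x - latticeVec z'‖ ≤ 2 * (N + 1)) : z = z' := by
  ext i
  have h1 := (PiLp.norm_apply_le (R⁻¹ • x - latticeVec z) i).trans hz
  have h2 := (PiLp.norm_apply_le (R⁻¹ • x - latticeVec z') i).trans hz'
  simp only [latticeVec, PiLp.sub_apply, PiLp.smul_apply, smul_eq_mul, Real.norm_eq_abs,
    abs_le] at h1 h2
  have h3 : ((4 * (N + 1) + 1 : ℕ) : ℤ) ∣ z' i - z i :=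
    (ZMod.intCast_eq_intCast_iff_dvd_sub _ _ _).1 (congrFun hcol i)
  have h4 : |z' i - z i| ≤ 4 * (N + 1) := by
    have : |((z' i - z i : ℤ) : ℝ)| ≤ 4 * (N + 1) := by
      push_cast
      rw [abs_le]
      constructor <;> linarith [h1.1, h1.2, h2.1, h2.2]
    exact_mod_cast this
  have h5 := Int.eq_zero_of_abs_lt_dvd h3 (by push_cast; linarith)
  linarith

/-- A density of mass `m` all of whose balls of radius `R (N + 1)` are light has `k`-th
eigenvalue at most of order `R⁻²`. -/
theorem mu_le_of_light_balls {N k : ℕ} {C m R : ℝ} (hm : 0 < m) (hR : 0 < R)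
    (hC : ∀ y, ‖fderiv ℝ (cellBump N) y‖ ≤ C) {ρ : EuclideanSpace ℝ (Fin N) → ℝ}
    (h0 : ∀ x, 0 ≤ ρ x) (hint : Integrable ρ) (hmass : ∫ x, ρ x = m) {a : ℝ}
    (ha : 0 < a) (ham : (4 * (N + 1) + 1) ^ N * ((k + 1) * (2 * a)) ≤ m / 2)
    (hlight : ∀ y, ∫ x in Metric.ball y (R * (N + 1)), ρ x ≤ a) :
    mu N k ρ ≤ ENNReal.ofReal ((k + 1) * (R⁻¹ * C) ^ 2 * m / a) := by
  classical
  have hcell : ∀ z : Fin N → ℤ, MeasurableSet (cellIndex R ⁻¹' {z}) := fun z =>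
    measurable_cellIndex R (measurableSet_singleton z)
  set w : (Fin N → ℤ) → ℝ := fun z => ∫ x in cellIndex R ⁻¹' {z}, ρ x
  have hwa : ∀ z, w z ≤ a := fun z =>
    (setIntegral_mono_set hint.integrableOn (.of_forall h0)
      (cell_subset_ball hR z).eventuallyLE).trans (hlight _)
  have hdisjcell : Pairwise (Function.onFun Disjoint
      fun z : Fin N → ℤ => cellIndex R ⁻¹' {z}) := fun z z' h =>
    Disjoint.preimage _ (by simpa using h)
  have hsum : HasSum w m := by
    have := hasSum_integral_iUnion hcell hdisjcell (f := ρ) (μ := volume) hint.integrableOn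
    rwa [← preimage_iUnion, iUnion_of_singleton, preimage_univ, setIntegral_univ, hmass] at this
  obtain ⟨S, hS⟩ := (hsum.eventually (lt_mem_nhds (half_lt_self hm))).exists
  obtain ⟨col, -, hcol⟩ := Finset.exists_le_sum_fiber_of_maps_to_of_nsmul_le_sum
    (s := S) (t := (Finset.univ : Finset (Fin N → ZMod (4 * (N + 1) + 1)))) (f := colour)
    (w := w) (b := (k + 1) * (2 * a)) (fun _ _ => Finset.mem_univ _) Finset.univ_nonempty (by
      refine le_trans (le_of_eq ?_) (ham.trans hS.le)
      simp [ZMod.card])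
  obtain ⟨G, hGS, hGd, hGa⟩ := exists_disjoint_heavy_subsets hwa ha (k + 1)
    (S.filter fun z => colour z = col) (by push_cast; linarith) ha.le
  have hGc : ∀ j, ∀ z ∈ G j, colour z = col := fun j z hz =>
    (Finset.mem_filter.1 (hGS j hz)).2
  have hsm : ∀ j, ContDiff ℝ (⊤ : ℕ∞) fun x => ∑ z ∈ G j, gridBump R z x := fun j =>
    ContDiff.sum fun z _ => contDiff_gridBump R z
  have hcs : ∀ j, HasCompactSupport fun x => ∑ z ∈ G j, gridBump R z x := fun j =>
    hasCompactSupport_finset_sum fun z => hasCompactSupport_gridBump hR z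
  rw [← hmass]
  refine mu_le_of_disjoint h0 hint (u := fun j x => ∑ z ∈ G j, gridBump R z x)
    hsm hcs ?_ ha ?_ ?_
  · intro i j hij x
    rw [Finset.sum_mul_sum]
    refine Finset.sum_eq_zero fun z hz => Finset.sum_eq_zero fun z' hz' => ?_
    by_contra h
    have hz0 := left_ne_zero_of_mul h
    have hz0' := right_ne_zero_of_mul h
    have := eq_of_colour_eq (R := R) (x := x) ((hGc i z hz).trans (hGc j z' hz').symm)
      (not_lt.1 fun h => hz0 (gridBump_eq_zero h.le))
      (not_lt.1 fun h => hz0' (gridBump_eq_zero h.le))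
    subst this
    exact Finset.disjoint_left.1 (hGd i j hij) hz hz'
  · intro j x
    rw [fderiv_fun_sum fun z _ => (contDiff_gridBump R z).differentiable (by simp) x]
    have hbound : ∀ z : Fin N → ℤ, ‖fderiv ℝ (gridBump R z) x‖ ≤ R⁻¹ * C := by
      intro z
      rw [fderiv_gridBump, norm_smul, Real.norm_of_nonneg (inv_nonneg.2 hR.le)]
      exact mul_le_mul_of_nonneg_left (hC _) (inv_nonneg.2 hR.le)
    by_cases h : ∃ z ∈ G j, ‖R⁻¹ • x - latticeVec z‖ ≤ 2 * (N + 1)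
    · obtain ⟨z, hz, hzx⟩ := h
      rw [Finset.sum_eq_single_of_mem z hz]
      · exact hbound z
      · intro z' hz' hne
        refine fderiv_gridBump_eq_zero (not_le.1 fun hle => hne ?_)
        exact eq_of_colour_eq ((hGc j z' hz').trans (hGc j z hz).symm) hle hzx
    · push Not at h
      rw [Finset.sum_eq_zero fun z hz => fderiv_gridBump_eq_zero (h z hz), norm_zero]
      exact (norm_nonneg _).trans (hbound 0)
  · intro j
    refine (hGa j).trans ?_
    have hint2 := integrable_mul_sq hint (hsm j).continuous (hcs j)
    rw [← integral_biUnion_finset (G j) (fun z _ => hcell z) (fun z _ z' _ h => hdisjcell h)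
      fun z _ => hint.integrableOn]
    refine le_trans ?_ (setIntegral_le_integral (s := ⋃ z ∈ G j, cellIndex R ⁻¹' {z}) hint2
      (.of_forall fun x => mul_nonneg (h0 x) (sq_nonneg _)))
    refine setIntegral_mono_on hint.integrableOn hint2.integrableOn
      ((G j).measurableSet_biUnion fun z _ => hcell z) fun x hx => ?_
    have hxG : cellIndex R x ∈ G j := by simpa using hx
    have h1 : 1 ≤ ∑ z ∈ G j, gridBump R z x := by
      rw [← gridBump_cellIndex R x]
      exact Finset.single_le_sum (f := fun z => gridBump R z x)
        (fun z _ => (cellBump N).nonneg) hxG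
    exact le_mul_of_one_le_right (h0 x) (one_le_pow₀ h1)

/-- Non-vanishing of maximizing sequences: if `(ρ_n) ⊂ L¹(ℝ^N,[0,1])` with `∫ρ_n = m`
is a maximizing sequence for `μ_k` over the mass-constrained class, with `μ_k(ρ_n)`
converging to the (positive) supremum, then it is false that for every `R > 0`,
`sup_y ∫_{B(y,R)} ρ_n → 0`. -/
theorem stmt_19 (N : ℕ) (hN : 1 ≤ N) (k : ℕ) (hk : 1 ≤ k) (m : ℝ) (hm : 0 < m)
    (ρ : ℕ → EuclideanSpace ℝ (Fin N) → ℝ)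
    (hmeas : ∀ n, Measurable (ρ n)) (h01 : ∀ n x, 0 ≤ ρ n x ∧ ρ n x ≤ 1)
    (hint : ∀ n, Integrable (ρ n)) (hmass : ∀ n, (∫ x, ρ n x) = m)
    (hmaximizing : Filter.Tendsto (fun n => mu N k (ρ n)) Filter.atTop
      (nhds (⨆ σ ∈ {σ : EuclideanSpace ℝ (Fin N) → ℝ | Measurable σ ∧
        (∀ x, 0 ≤ σ x ∧ σ x ≤ 1) ∧ Integrable σ ∧ (∫ x, σ x) = m}, mu N k σ)))
    (hpos : 0 < ⨆ σ ∈ {σ : EuclideanSpace ℝ (Fin N) → ℝ | Measurable σ ∧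
        (∀ x, 0 ≤ σ x ∧ σ x ≤ 1) ∧ Integrable σ ∧ (∫ x, σ x) = m}, mu N k σ) :
    ¬ (∀ R > (0 : ℝ), Filter.Tendsto
        (fun n => ⨆ y : EuclideanSpace ℝ (Fin N), ∫ x in Metric.ball y R, ρ n x)
        Filter.atTop (nhds 0)) := by
  intro hvan
  obtain ⟨M, hM0, hML⟩ := ENNReal.lt_iff_exists_nnreal_btwn.1 hpos
  have hM : (0 : ℝ) < M := by exact_mod_cast hM0
  obtain ⟨C, hC⟩ := ((cellBump N).hasCompactSupport.fderiv ℝ).exists_bound_of_continuous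
    (((cellBump N).contDiff (n := 1)).continuous_fderiv (by simp))
  obtain ⟨a, ha, ham⟩ : ∃ a : ℝ, 0 < a ∧
      (4 * (N + 1) + 1) ^ N * ((k + 1) * (2 * a)) ≤ m / 2 := by
    refine ⟨m / (4 * (4 * (N + 1) + 1) ^ N * (k + 1)), by positivity, le_of_eq ?_⟩
    field_simp
    ring
  obtain ⟨R, hR, hRM⟩ : ∃ R : ℝ, 0 < R ∧ (k + 1) * (R⁻¹ * C) ^ 2 * m / a ≤ M := by
    have h1 : Filter.Tendsto (fun R : ℝ => (k + 1) * (R⁻¹ * C) ^ 2 * m / a) Filter.atTop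
        (nhds ((k + 1) * (0 * C) ^ 2 * m / a)) :=
      ((((tendsto_inv_atTop_zero.mul_const C).pow 2).const_mul _).mul_const m).div_const a
    have h2 := h1.eventually_le_const (u := (M : ℝ)) (by simpa using hM)
    obtain ⟨R, hR1, hR2⟩ := ((Filter.eventually_gt_atTop 0).and h2).exists
    exact ⟨R, hR1, hR2⟩
  have hev := (hvan (R * (N + 1)) (by positivity)).eventually_le_const ha
  refine absurd (le_of_tendsto hmaximizing (hev.mono fun n hn => ?_)) (not_le.2 hML)
  refine (mu_le_of_light_balls hm hR hC (fun x => (h01 n x).1) (hint n) (hmass n) ha ham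
    fun y => (le_ciSup ⟨m, ?_⟩ y).trans hn).trans ?_
  · rintro _ ⟨y, rfl⟩
    exact (setIntegral_le_integral (hint n) (.of_forall fun x => (h01 n x).1)).trans
      (hmass n).le
  · rw [← ENNReal.ofReal_coe_nnreal]
    exact ENNReal.ofReal_le_ofReal hRM
end
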